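/- (Uniform convergence of densities for kernels with bounded densities.) Let M be a compact Borel subset of ℝ^d with vol(M) > 0, and let K : M × M → ℝ be jointly measurable with ∫_M K(x, z) dz = 1 for every x ∈ M and 0 < c₋ ≤ K(x, z) ≤ c₊ for all x, z ∈ M. Let P be the Markov kernel on M defined by P(x, A) = ∫_A K(x, z) dz and set θ = 1 − vol(M) · c₋. For a probability measure μ and t ≥ 1, the measure μP^t is absolutely continuous with density ρ_{μ,t}(z) = ∫ K(x, z) d(μP^{t−1})(x). Then for any two probability measures μ, ν on M and every t ≥ 1, sup over z ∈ M of |ρ_{μ,t}(z) − ρ_{ν,t}(z)| ≤ c₊ · θ^{t−1} · ‖μ − ν‖_TV, where ‖σ‖_TV = |σ|(M) is the total variation norm of the signed measure σ. -/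

import Mathlib

open MeasureTheory Set
open scoped ENNReal

/-- The Markov kernel with transition density `K` with respect to Lebesgue measure
restricted to `M`:  `P(x, A) = ∫_{A ∩ M} K(x, z) dz`. -/
noncomputable def densityKernel {d : ℕ} (M : Set (EuclideanSpace ℝ (Fin d)))
    (K : EuclideanSpace ℝ (Fin d) → EuclideanSpace ℝ (Fin d) → ℝ)
    (x : EuclideanSpace ℝ (Fin d)) : Measure (EuclideanSpace ℝ (Fin d)) :=
  (volume.restrict M).withDensity (fun z => ENNReal.ofReal (K x z))

/-- The distribution `μ P^t` after `t` steps of the chain with kernel `P` started from `μ`. -/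
noncomputable def iterMeas {X : Type*} [MeasurableSpace X]
    (P : X → Measure X) (t : ℕ) (μ : Measure X) : Measure X :=
  (fun ν => ν.bind P)^[t] μ

/-- The total variation norm `‖μ − ν‖_TV = |μ − ν|(M)`, expressed via the Jordan
decomposition `|μ − ν| = (μ − ν) + (ν − μ)` (truncated subtraction of measures). -/
noncomputable def tvNormOn {X : Type*} [MeasurableSpace X] (M : Set X)
    (μ ν : Measure X) : ℝ :=
  ((μ - ν) M + (ν - μ) M).toReal

section Bind

variable {X : Type*} [MeasurableSpace X]

/-- `Measure.bind` is additive in the measure. -/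
theorem bind_add_left {P : X → Measure X} (hP : Measurable P) (μ ν : Measure X) :
    (μ + ν).bind P = μ.bind P + ν.bind P := by
  ext s hs
  simp [Measure.bind_apply hs hP.aemeasurable]

/-- If `P x = Q x + κ` for `μ`-almost every `x`, then `μ P = μ Q + μ(X) κ`. -/
theorem bind_eq_bind_add_smul {P Q : X → Measure X} (hP : Measurable P) (hQ : Measurable Q)
    {κ μ : Measure X} (h : ∀ᵐ x ∂μ, P x = Q x + κ) :
    μ.bind P = μ.bind Q + μ univ • κ := by
  ext s hs
  rw [Measure.bind_apply hs hP.aemeasurable, Measure.add_apply,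
    Measure.bind_apply hs hQ.aemeasurable, Measure.smul_apply, smul_eq_mul]
  calc ∫⁻ x, P x s ∂μ = ∫⁻ x, (Q x s + κ s) ∂μ :=
        lintegral_congr_ae (h.mono fun x hx => by simp [hx])
    _ = ∫⁻ x, Q x s ∂μ + μ univ * κ s := by
        rw [lintegral_add_right _ measurable_const, lintegral_const, mul_comm (κ s)]

/-- If `P x s = c` for `μ`-almost every `x`, then `(μ P)(s) = c μ(X)`. -/
theorem bind_apply_eq_mul {P : X → Measure X} (hP : Measurable P) {μ : Measure X} {s : Set X}
    (hs : MeasurableSet s) {c : ℝ≥0∞} (h : ∀ᵐ x ∂μ, P x s = c) :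
    μ.bind P s = c * μ univ := by
  rw [Measure.bind_apply hs hP.aemeasurable, lintegral_congr_ae h, lintegral_const]

theorem iterMeas_succ (P : X → Measure X) (n : ℕ) (μ : Measure X) :
    iterMeas P (n + 1) μ = (iterMeas P n μ).bind P :=
  Function.iterate_succ_apply' _ _ _

theorem iterMeas_univ_and_compl {P : X → Measure X} (hP : Measurable P) {M : Set X}
    (hM : MeasurableSet M) (hPuniv : ∀ x ∈ M, P x univ = 1) (hPM : ∀ x ∈ M, P x Mᶜ = 0)
    {μ : Measure X} (hμ : μ Mᶜ = 0) (n : ℕ) :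
    iterMeas P n μ univ = μ univ ∧ iterMeas P n μ Mᶜ = 0 := by
  induction n with
  | zero => exact ⟨rfl, hμ⟩
  | succ n ih =>
    have hae : ∀ᵐ x ∂(iterMeas P n μ), x ∈ M := ih.2
    rw [iterMeas_succ, bind_apply_eq_mul hP .univ (hae.mono hPuniv),
      bind_apply_eq_mul hP hM.compl (hae.mono hPM), one_mul, zero_mul]
    exact ⟨ih.1, rfl⟩

/-- Under a minorization `P x = Q x + κ` on `M`, with `Q x` of mass `c`, the difference of two
measures after `n` steps is a difference of two measures whose mass has shrunk by `c ^ n`. -/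
theorem exists_iterMeas_add_eq {P Q : X → Measure X} (hP : Measurable P) (hQ : Measurable Q)
    {M : Set X} (hM : MeasurableSet M) {κ : Measure X} [IsFiniteMeasure κ]
    (hPQ : ∀ x ∈ M, P x = Q x + κ) {c : ℝ≥0∞} (hc : c ≠ ∞) (hQuniv : ∀ x ∈ M, Q x univ = c)
    (hQM : ∀ x ∈ M, Q x Mᶜ = 0) {μ ν α β : Measure X}
    (hα : α Mᶜ = 0) (hβ : β Mᶜ = 0) {a : ℝ≥0∞} (ha : a ≠ ∞) (hαa : α univ = a) (hβa : β univ = a)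
    (h : μ + β = ν + α) (n : ℕ) :
    ∃ α' β' : Measure X, iterMeas P n μ + β' = iterMeas P n ν + α' ∧
      α' univ = c ^ n * a ∧ β' univ = c ^ n * a ∧ α' Mᶜ = 0 ∧ β' Mᶜ = 0 := by
  induction n with
  | zero => exact ⟨α, β, h, by simpa using hαa, by simpa using hβa, hα, hβ⟩
  | succ n ih =>
    obtain ⟨α', β', h', hα'a, hβ'a, hα', hβ'⟩ := ih
    have hαM : ∀ᵐ x ∂α', x ∈ M := hα'
    have hβM : ∀ᵐ x ∂β', x ∈ M := hβ'
    refine ⟨α'.bind Q, β'.bind Q, ?_, ?_, ?_, ?_, ?_⟩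
    · have hb := congrArg (fun σ : Measure X => σ.bind P) h'
      simp only [bind_add_left hP, bind_eq_bind_add_smul hP hQ (hαM.mono hPQ),
        bind_eq_bind_add_smul hP hQ (hβM.mono hPQ), hα'a, hβ'a] at hb
      rw [iterMeas_succ, iterMeas_succ]
      ext s hs
      have hbs := congrArg (fun σ : Measure X => σ s) hb
      simp only [Measure.add_apply, Measure.smul_apply, smul_eq_mul, ← add_assoc] at hbs ⊢
      have hfin : c ^ n * a * κ s ≠ ∞ :=
        ENNReal.mul_ne_top (ENNReal.mul_ne_top (ENNReal.pow_ne_top hc) ha) (measure_ne_top κ s)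
      exact (ENNReal.add_left_inj hfin).1 hbs
    · rw [bind_apply_eq_mul hQ .univ (hαM.mono hQuniv), hα'a, pow_succ', mul_assoc]
    · rw [bind_apply_eq_mul hQ .univ (hβM.mono hQuniv), hβ'a, pow_succ', mul_assoc]
    · rw [bind_apply_eq_mul hQ hM.compl (hαM.mono hQM), zero_mul]
    · rw [bind_apply_eq_mul hQ hM.compl (hβM.mono hQM), zero_mul]

/-- The Jordan decomposition of `μ - ν`, written without subtraction of signed measures. -/
theorem add_sub_eq_add_sub_of_isFiniteMeasure (μ ν : Measure X) [IsFiniteMeasure μ]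
    [IsFiniteMeasure ν] : μ + (ν - μ) = ν + (μ - ν) := by
  apply Measure.toSignedMeasure_eq_toSignedMeasure_iff.1
  have h := Measure.sub_toSignedMeasure_eq_toSignedMeasure_sub (μ := μ) (ν := ν)
  rw [Measure.toSignedMeasure_add, Measure.toSignedMeasure_add]
  rw [sub_eq_sub_iff_add_eq_add] at h
  rw [h, add_comm]

/-- Adding to two measures `μ`, `ν` remainders of mass `a` that make them equal bounds the
difference of the integrals of a function with values in `[0, C]`. -/
theorem abs_integral_sub_integral_le_of_add_eq {M : Set X} {μ ν α β : Measure X}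
    [IsFiniteMeasure μ] [IsFiniteMeasure ν] [IsFiniteMeasure α] [IsFiniteMeasure β]
    (hμ : μ Mᶜ = 0) (hν : ν Mᶜ = 0) (hα : α Mᶜ = 0) (hβ : β Mᶜ = 0) (h : μ + β = ν + α)
    {f : X → ℝ} (hf : Measurable f) {C : ℝ} (hf0 : ∀ x ∈ M, 0 ≤ f x) (hfC : ∀ x ∈ M, f x ≤ C)
    {a : ℝ} (hαa : α.real univ = a) (hβa : β.real univ = a) :
    |(∫ x, f x ∂μ) - ∫ x, f x ∂ν| ≤ C * a := by
  have hint : ∀ σ : Measure X, IsFiniteMeasure σ → σ Mᶜ = 0 → Integrable f σ := by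
    intro σ _ hσ
    have hσM : ∀ᵐ x ∂σ, x ∈ M := hσ
    refine Integrable.of_bound hf.aestronglyMeasurable C (hσM.mono fun x hx => ?_)
    rw [Real.norm_of_nonneg (hf0 x hx)]
    exact hfC x hx
  have hbd : ∀ σ : Measure X, IsFiniteMeasure σ → σ Mᶜ = 0 → σ.real univ = a →
      0 ≤ ∫ x, f x ∂σ ∧ ∫ x, f x ∂σ ≤ C * a := by
    intro σ hfin hσ hσa
    have hσM : ∀ᵐ x ∂σ, x ∈ M := hσ
    refine ⟨integral_nonneg_of_ae (hσM.mono hf0), ?_⟩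
    calc ∫ x, f x ∂σ ≤ ∫ _, C ∂σ :=
          integral_mono_ae (hint σ hfin hσ) (integrable_const C) (hσM.mono hfC)
      _ = C * a := by rw [integral_const, hσa, smul_eq_mul, mul_comm]
  have hsum : ∫ x, f x ∂(μ + β) = ∫ x, f x ∂(ν + α) := by rw [h]
  rw [integral_add_measure (hint μ ‹_› hμ) (hint β ‹_› hβ),
    integral_add_measure (hint ν ‹_› hν) (hint α ‹_› hα)] at hsum
  have h1 := hbd α ‹_› hα hαa
  have h2 := hbd β ‹_› hβ hβa
  rw [abs_le]
  constructor <;> linarith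

end Bind

theorem measurable_densityKernel {d : ℕ} {M : Set (EuclideanSpace ℝ (Fin d))}
    {K : EuclideanSpace ℝ (Fin d) → EuclideanSpace ℝ (Fin d) → ℝ}
    (hK : Measurable (Function.uncurry K)) : Measurable (densityKernel M K) := by
  refine Measure.measurable_of_measurable_coe _ fun s hs => ?_
  simp only [densityKernel, withDensity_apply _ hs]
  exact Measurable.lintegral_prod_right (f := fun x z => ENNReal.ofReal (K x z)) hK.ennreal_ofReal

theorem densityKernel_compl {d : ℕ} {M : Set (EuclideanSpace ℝ (Fin d))} (hM : MeasurableSet M)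
    (K : EuclideanSpace ℝ (Fin d) → EuclideanSpace ℝ (Fin d) → ℝ)
    (x : EuclideanSpace ℝ (Fin d)) : densityKernel M K x Mᶜ = 0 :=
  withDensity_absolutelyContinuous _ _ (by simp [Measure.restrict_apply hM.compl])

theorem densityKernel_univ {d : ℕ} {M : Set (EuclideanSpace ℝ (Fin d))} (hM : MeasurableSet M)
    {K : EuclideanSpace ℝ (Fin d) → EuclideanSpace ℝ (Fin d) → ℝ}
    {x : EuclideanSpace ℝ (Fin d)} (hint : IntegrableOn (K x) M) (h0 : ∀ z ∈ M, 0 ≤ K x z) :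
    densityKernel M K x univ = ENNReal.ofReal (∫ z in M, K x z) := by
  rw [densityKernel, withDensity_apply _ .univ, Measure.restrict_univ,
    ofReal_integral_eq_lintegral_ofReal hint (ae_restrict_of_forall_mem hM h0)]

/-- A lower bound on the density splits a multiple of Lebesgue measure off the kernel. -/
theorem densityKernel_eq_add_smul {d : ℕ} {M : Set (EuclideanSpace ℝ (Fin d))}
    (hM : MeasurableSet M) {K : EuclideanSpace ℝ (Fin d) → EuclideanSpace ℝ (Fin d) → ℝ}
    {x : EuclideanSpace ℝ (Fin d)} {c : ℝ} (hc : 0 ≤ c) (h : ∀ z ∈ M, c ≤ K x z) :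
    densityKernel M K x =
      densityKernel M (fun x z => K x z - c) x + ENNReal.ofReal c • volume.restrict M := by
  rw [densityKernel, densityKernel, ← withDensity_const, ← withDensity_add_right _ measurable_const]
  refine withDensity_congr_ae (ae_restrict_of_forall_mem hM fun z hz => ?_)
  simp only [Pi.add_apply]
  rw [← ENNReal.ofReal_add (sub_nonneg.2 (h z hz)) hc, sub_add_cancel]

/-- **Uniform convergence of densities.** If in addition `K ≤ c₊`, then the
densities `ρ_{μ,t}(z) = ∫ K(x,z) d(μP^{t−1})(x)` of the iterates satisfy
`sup_{z ∈ M} |ρ_{μ,t}(z) − ρ_{ν,t}(z)| ≤ c₊ θ^{t−1} ‖μ − ν‖_TV` with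
`θ = 1 − vol(M) c₋`. -/
theorem density_uniform_convergence
    (d : ℕ) (M : Set (EuclideanSpace ℝ (Fin d)))
    (hMcompact : IsCompact M) (hMmeas : MeasurableSet M) (hMvol : 0 < volume M)
    (K : EuclideanSpace ℝ (Fin d) → EuclideanSpace ℝ (Fin d) → ℝ)
    (hKmeas : Measurable (Function.uncurry K))
    (cmin cmax : ℝ) (hc : 0 < cmin)
    (hKlb : ∀ x ∈ M, ∀ z ∈ M, cmin ≤ K x z)
    (hKub : ∀ x ∈ M, ∀ z ∈ M, K x z ≤ cmax)
    (hKint : ∀ x ∈ M, ∫ z in M, K x z = 1) :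
    ∀ μ ν : Measure (EuclideanSpace ℝ (Fin d)),
      IsProbabilityMeasure μ → μ M = 1 → IsProbabilityMeasure ν → ν M = 1 →
      ∀ t : ℕ, 1 ≤ t → ∀ z ∈ M,
        |(∫ x, K x z ∂(iterMeas (densityKernel M K) (t - 1) μ)) -
            (∫ x, K x z ∂(iterMeas (densityKernel M K) (t - 1) ν))| ≤
          cmax * (1 - (volume M).toReal * cmin) ^ (t - 1) * tvNormOn M μ ν := by
  intro μ ν hμ hμM hν hνM t _ z hz
  have hvol : volume M ≠ ∞ := hMcompact.measure_lt_top.ne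
  have hKint' : ∀ x ∈ M, IntegrableOn (K x) M := fun x hx =>
    Integrable.of_integral_ne_zero (by rw [hKint x hx]; exact one_ne_zero)
  have hK0 : ∀ x ∈ M, ∀ y ∈ M, 0 ≤ K x y := fun x hx y hy => hc.le.trans (hKlb x hx y hy)
  set θ : ℝ := 1 - (volume M).toReal * cmin with hθ
  have hQint : ∀ x ∈ M, ∫ y in M, (K x y - cmin) = θ := by
    intro x hx
    rw [integral_sub (hKint' x hx) (integrableOn_const hvol), hKint x hx, setIntegral_const,
      smul_eq_mul, Measure.real]
  have hθ0 : 0 ≤ θ := by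
    rw [← hQint z hz]
    exact setIntegral_nonneg hMmeas fun y hy => sub_nonneg.2 (hKlb z hz y hy)
  have hCpos : 0 ≤ cmax := (hK0 z hz z hz).trans (hKub z hz z hz)
  have hP := measurable_densityKernel (M := M) hKmeas
  have hQ := measurable_densityKernel (M := M) (K := fun x y => K x y - cmin)
    (hKmeas.sub_const cmin)
  have hPuniv : ∀ x ∈ M, densityKernel M K x univ = 1 := fun x hx => by
    rw [densityKernel_univ hMmeas (hKint' x hx) (hK0 x hx), hKint x hx, ENNReal.ofReal_one]
  have hQuniv : ∀ x ∈ M, densityKernel M (fun x y => K x y - cmin) x univ = ENNReal.ofReal θ :=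
    fun x hx => by
      rw [densityKernel_univ hMmeas ((hKint' x hx).sub (integrableOn_const hvol))
        (fun y hy => sub_nonneg.2 (hKlb x hx y hy)), hQint x hx]
  have hμ0 : μ Mᶜ = 0 := (prob_compl_eq_zero_iff hMmeas).2 hμM
  have hν0 : ν Mᶜ = 0 := (prob_compl_eq_zero_iff hMmeas).2 hνM
  have hα0 : (μ - ν) Mᶜ = 0 := le_antisymm ((Measure.sub_le (μ := μ) _).trans hμ0.le) zero_le
  have hβ0 : (ν - μ) Mᶜ = 0 := le_antisymm ((Measure.sub_le (μ := ν) _).trans hν0.le) zero_le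
  have hsplit := add_sub_eq_add_sub_of_isFiniteMeasure μ ν
  have hmass : (ν - μ) univ = (μ - ν) univ := by
    have h := congrArg (fun σ : Measure _ => σ univ) hsplit
    simp only [Measure.add_apply, measure_univ] at h
    exact (ENNReal.add_right_inj ENNReal.one_ne_top).1 h
  have : Fact (volume M < ∞) := ⟨hMcompact.measure_lt_top⟩
  have hκ : IsFiniteMeasure (ENNReal.ofReal cmin • volume.restrict M) :=
    Measure.smul_finite _ ENNReal.ofReal_ne_top
  obtain ⟨α, β, hαβ, hαa, hβa, hα, hβ⟩ := exists_iterMeas_add_eq hP hQ hMmeas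
    (fun x hx => densityKernel_eq_add_smul hMmeas hc.le (hKlb x hx)) ENNReal.ofReal_ne_top hQuniv
    (fun x _ => densityKernel_compl hMmeas _ x) hα0 hβ0 (measure_ne_top _ _) rfl hmass hsplit
    (t - 1)
  obtain ⟨hμt, hμt0⟩ := iterMeas_univ_and_compl hP hMmeas hPuniv
    (fun x _ => densityKernel_compl hMmeas K x) hμ0 (t - 1)
  obtain ⟨hνt, hνt0⟩ := iterMeas_univ_and_compl hP hMmeas hPuniv
    (fun x _ => densityKernel_compl hMmeas K x) hν0 (t - 1)
  have hfin : ENNReal.ofReal θ ^ (t - 1) * (μ - ν) univ < ∞ :=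
    ENNReal.mul_lt_top (ENNReal.pow_lt_top ENNReal.ofReal_lt_top) (measure_lt_top _ _)
  have : IsFiniteMeasure α := ⟨hαa ▸ hfin⟩
  have : IsFiniteMeasure β := ⟨hβa ▸ hfin⟩
  have : IsFiniteMeasure (iterMeas (densityKernel M K) (t - 1) μ) := ⟨hμt ▸ measure_lt_top μ _⟩
  have : IsFiniteMeasure (iterMeas (densityKernel M K) (t - 1) ν) := ⟨hνt ▸ measure_lt_top ν _⟩
  have hreal : (ENNReal.ofReal θ ^ (t - 1) * (μ - ν) univ).toReal =
      θ ^ (t - 1) * (μ - ν).real univ := by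
    rw [ENNReal.toReal_mul, ENNReal.toReal_pow, ENNReal.toReal_ofReal hθ0, Measure.real]
  have hTV : (μ - ν).real univ ≤ tvNormOn M μ ν := by
    have hM : (μ - ν) univ = (μ - ν) M := by
      rw [← measure_add_measure_compl hMmeas, hα0, add_zero]
    rw [Measure.real, hM, tvNormOn]
    exact ENNReal.toReal_mono (ENNReal.add_ne_top.2 ⟨measure_ne_top _ _, measure_ne_top _ _⟩)
      le_self_add
  calc |(∫ x, K x z ∂(iterMeas (densityKernel M K) (t - 1) μ)) -
          ∫ x, K x z ∂(iterMeas (densityKernel M K) (t - 1) ν)|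
      ≤ cmax * (θ ^ (t - 1) * (μ - ν).real univ) :=
        abs_integral_sub_integral_le_of_add_eq hμt0 hνt0 hα hβ hαβ hKmeas.of_uncurry_right
          (fun x hx => hK0 x hx z hz) (fun x hx => hKub x hx z hz)
          (by rw [← hreal, ← hαa, Measure.real]) (by rw [← hreal, ← hβa, Measure.real])
    _ ≤ cmax * θ ^ (t - 1) * tvNormOn M μ ν := by
        rw [← mul_assoc]
        gcongr
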